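/- arXiv:2108.08004 — 2 statements merged into one kernel-verified Lean document; each statement's English description precedes it below -/
import Mathlib

section
/- Let G be a transitive digraph, f a discrete Morse function on G, and α an allowed elementary n-path on G. Define for t ∈ ℝ the quantity λ_α(t) = Σ_{β<α} ⟨∂α,β⟩² e^{2t(f(β)−f(α))} + Σ_{γ>α} ⟨∂γ,α⟩² e^{2t(f(α)−f(γ))}, where β ranges over allowed elementary (n−1)-paths with β < α and γ over allowed elementary (n+1)-paths with γ > α. Then λ_α(t) → 0 as t → ∞ if and only if α is critical. -/
open scoped BigOperators Classical

namespace PathMorse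

/-- A digraph: an irreflexive edge relation on a vertex set. -/
structure Digraph (V : Type) where
  E : V → V → Prop
  irrefl : ∀ v, ¬ E v v

/-- A digraph is transitive if `u→v` and `v→w` imply `u→w`. -/
def Digraph.Transitive {V : Type} (G : Digraph V) : Prop :=
  ∀ u v w, G.E u v → G.E v w → G.E u w

/-- `Gbar` is the transitive closure of `G`: the smallest transitive digraph containing `G`. -/
def IsTransClosure {V : Type} (G Gbar : Digraph V) : Prop :=
  Gbar.Transitive ∧ (∀ u v, G.E u v → Gbar.E u v) ∧
    ∀ H : Digraph V, H.Transitive → (∀ u v, G.E u v → H.E u v) →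
      ∀ u v, Gbar.E u v → H.E u v

/-- An elementary `n`-path on `V`: a sequence of `n+1` vertices. -/
abbrev Path (V : Type) (n : ℕ) := Fin (n+1) → V

/-- An elementary path is allowed on `G` if consecutive vertices are joined by directed edges. -/
def Allowed {V : Type} (G : Digraph V) {n : ℕ} (p : Path V n) : Prop :=
  ∀ i : Fin n, G.E (p i.castSucc) (p i.succ)

/-- The `i`-th face of a path: delete the `i`-th vertex. -/
def face {V : Type} {n : ℕ} (i : Fin (n+2)) (p : Path V (n+1)) : Path V n :=
  p ∘ i.succAbove

/-- `q` is obtained from `p` by deleting one vertex (the codimension-one relation `q < p`). -/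
def IsFace {V : Type} {n : ℕ} (q : Path V n) (p : Path V (n+1)) : Prop :=
  ∃ i : Fin (n+2), face i p = q

/-- Value of `f` on a path: sum of the values at the vertices. -/
def fPath {V : Type} (f : V → ℝ) {n : ℕ} (p : Path V n) : ℝ :=
  ∑ i, f (p i)

/-- There is an allowed coface `γ > p` with `f γ = f p`. -/
def HasEqualCoface {V : Type} (G : Digraph V) (f : V → ℝ) {n : ℕ} (p : Path V n) : Prop :=
  ∃ γ : Path V (n+1), Allowed G γ ∧ IsFace p γ ∧ fPath f γ = fPath f p

/-- There is an allowed face `β < p` with `f β = f p`. -/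
def HasEqualFace {V : Type} (G : Digraph V) (f : V → ℝ) : (n : ℕ) → Path V n → Prop
  | 0, _ => False
  | (n+1), p => ∃ β : Path V n, Allowed G β ∧ IsFace β p ∧ fPath f β = fPath f p

/-- A discrete Morse function on a digraph: nonnegative, and for each allowed elementary path
there is at most one allowed coface with the same value, and at most one allowed face with the
same value. -/
def IsMorse {V : Type} (G : Digraph V) (f : V → ℝ) : Prop :=
  (∀ v, 0 ≤ f v) ∧
  (∀ n (α : Path V n), Allowed G α →
    ∀ γ₁ γ₂ : Path V (n+1), Allowed G γ₁ → Allowed G γ₂ → IsFace α γ₁ → IsFace α γ₂ →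
      fPath f γ₁ = fPath f α → fPath f γ₂ = fPath f α → γ₁ = γ₂) ∧
  (∀ n (α : Path V (n+1)), Allowed G α →
    ∀ β₁ β₂ : Path V n, Allowed G β₁ → Allowed G β₂ → IsFace β₁ α → IsFace β₂ α →
      fPath f β₁ = fPath f α → fPath f β₂ = fPath f α → β₁ = β₂)

/-- A critical path: allowed, with no allowed coface of equal value, no allowed face of equal value. -/
def IsCritical {V : Type} (G : Digraph V) (f : V → ℝ) {n : ℕ} (p : Path V n) : Prop :=
  Allowed G p ∧ ¬ HasEqualCoface G f p ∧ ¬ HasEqualFace G f n p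

/-- `n`-chains: the real vector space with (orthonormal) basis the elementary `n`-paths. -/
abbrev Chain (V : Type) (n : ℕ) := Path V n → ℝ

variable {V : Type} [Fintype V] [DecidableEq V]

/-- The basis chain corresponding to an elementary path. -/
def unitP {n : ℕ} (p : Path V n) : Chain V n := Pi.single p 1

/-- The boundary operator on chains (as a bare function). -/
def boundaryFun {n : ℕ} (x : Chain V (n+1)) : Chain V n :=
  fun q => ∑ p : Path V (n+1), x p * ∑ i : Fin (n+2), ((-1:ℝ)^(i:ℕ)) * (if face i p = q then 1 else 0)

/-- The boundary operator `∂ = Σ (-1)^i d_i` as a linear map. -/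
def boundary (V : Type) [Fintype V] [DecidableEq V] (n : ℕ) : Chain V (n+1) →ₗ[ℝ] Chain V n where
  toFun := boundaryFun
  map_add' x y := by
    funext q
    simp [boundaryFun, add_mul, Finset.sum_add_distrib]
  map_smul' c x := by
    funext q
    simp [boundaryFun, Finset.mul_sum, mul_assoc]

/-- `P_n(G)`: the span of the allowed elementary `n`-paths. -/
def pSpan (G : Digraph V) (n : ℕ) : Submodule ℝ (Chain V n) :=
  Submodule.span ℝ {x : Chain V n | ∃ p : Path V n, Allowed G p ∧ x = unitP p}

/-- `Ω_n(G) = {x ∈ P_n(G) : ∂x ∈ P_{n-1}(G)}` (with `Ω_0 = P_0`). -/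
def omega (G : Digraph V) : (n : ℕ) → Submodule ℝ (Chain V n)
  | 0 => pSpan G 0
  | (n+1) => pSpan G (n+1) ⊓ (pSpan G n).comap (boundary V n)

/-- The discrete gradient vector field on a basis path: `V(α) = -⟨∂γ,α⟩ γ` if there is an
allowed coface `γ > α` with `f γ = f α`, and `0` otherwise. -/
noncomputable def gradFun (G : Digraph V) (f : V → ℝ) {n : ℕ} (α : Path V n) : Chain V (n+1) :=
  if h : Allowed G α ∧ ∃ γ : Path V (n+1), Allowed G γ ∧ IsFace α γ ∧ fPath f γ = fPath f α then
    (-(boundary V n (unitP h.2.choose) α)) • unitP h.2.choose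
  else 0

/-- The discrete gradient vector field `V = grad f`, extended linearly to chains. -/
noncomputable def grad (G : Digraph V) (f : V → ℝ) (n : ℕ) : Chain V n →ₗ[ℝ] Chain V (n+1) where
  toFun x := ∑ α : Path V n, x α • gradFun G f α
  map_add' x y := by simp [add_smul, Finset.sum_add_distrib]
  map_smul' c x := by simp [Finset.smul_sum, smul_smul]

/-- The composite `V∂` in degree `n` (zero in degree `0`). -/
noncomputable def vd (G : Digraph V) (f : V → ℝ) : (n : ℕ) → (Chain V n →ₗ[ℝ] Chain V n)
  | 0 => 0
  | (n+1) => (grad G f n).comp (boundary V n)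

/-- The discrete gradient flow `Φ = Id + ∂V + V∂`. -/
noncomputable def flow (G : Digraph V) (f : V → ℝ) (n : ℕ) : Chain V n →ₗ[ℝ] Chain V n :=
  LinearMap.id + (boundary V n).comp (grad G f n) + vd G f n

/-- `P_n^Φ(G) = {x ∈ P_n(G) : Φ x = x}`. -/
noncomputable def pPhi (G : Digraph V) (f : V → ℝ) (n : ℕ) : Submodule ℝ (Chain V n) :=
  pSpan G n ⊓ LinearMap.ker (flow G f n - LinearMap.id)

/-- The cycles of a chain complex of subspaces `C` with differentials `D`
(in degree `0`, everything is a cycle). -/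
def cycles (C : ∀ n, Submodule ℝ (Chain V n)) (D : ∀ n, Chain V (n+1) →ₗ[ℝ] Chain V n) :
    (m : ℕ) → Submodule ℝ (Chain V m)
  | 0 => C 0
  | (m+1) => C (m+1) ⊓ LinearMap.ker (D m)

/-- Homology of the chain complex `(C, D)`: cycles modulo boundaries coming from `C`. -/
abbrev Homology (C : ∀ n, Submodule ℝ (Chain V n)) (D : ∀ n, Chain V (n+1) →ₗ[ℝ] Chain V n)
    (m : ℕ) :=
  (cycles C D m) ⧸ (Submodule.comap (cycles C D m).subtype ((C (m+1)).map (D m)))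

/-- The operator `e^{tf}` on chains. -/
noncomputable def expOp (f : V → ℝ) (t : ℝ) (n : ℕ) : Chain V n →ₗ[ℝ] Chain V n where
  toFun x := fun p => Real.exp (t * fPath f p) * x p
  map_add' x y := by funext p; simp [mul_add]
  map_smul' c x := by funext p; simp; ring

/-- The deformed boundary `∂_t = e^{tf} ∂ e^{-tf}`. -/
noncomputable def dT (f : V → ℝ) (t : ℝ) (n : ℕ) : Chain V (n+1) →ₗ[ℝ] Chain V n :=
  (expOp f t n).comp ((boundary V n).comp (expOp f (-t) (n+1)))

/-- The span of the elementary `n`-paths that are critical in `Gbar` and allowed in `G`. -/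
def critSpan (G Gbar : Digraph V) (f : V → ℝ) (n : ℕ) : Submodule ℝ (Chain V n) :=
  Submodule.span ℝ {x : Chain V n | ∃ α : Path V n, IsCritical Gbar f α ∧ Allowed G α ∧ x = unitP α}

/-- The Witten–Laplacian diagonal term
`λ_α(t) = Σ_{β<α allowed} ⟨∂α,β⟩² e^{2t(fβ-fα)} + Σ_{γ>α allowed} ⟨∂γ,α⟩² e^{2t(fα-fγ)}`. -/
noncomputable def lam {V : Type} [Fintype V] [DecidableEq V] (G : Digraph V) (f : V → ℝ) :
    (n : ℕ) → Path V n → ℝ → ℝ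
  | 0, α, t => ∑ γ : Path V 1, (if Allowed G γ then 1 else 0) *
      (boundary V 0 (unitP γ) α)^2 * Real.exp (2*t*(fPath f α - fPath f γ))
  | (m+1), α, t =>
      (∑ β : Path V m, (if Allowed G β then 1 else 0) *
        (boundary V m (unitP α) β)^2 * Real.exp (2*t*(fPath f β - fPath f α)))
      + ∑ γ : Path V (m+2), (if Allowed G γ then 1 else 0) *
        (boundary V (m+1) (unitP γ) α)^2 * Real.exp (2*t*(fPath f α - fPath f γ))

/-- Deleting different vertices of an allowed path gives different faces. -/
lemma face_injective {V : Type} {G : Digraph V} {n : ℕ} {p : Path V (n + 1)}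
    (hp : Allowed G p) : Function.Injective fun i => face i p := by
  have key : ∀ i j : Fin (n + 2), i < j → face i p ≠ face j p := by
    intro i j hij h
    have hi : i ≠ Fin.last (n + 1) := (hij.trans_le (Fin.le_last j)).ne
    obtain ⟨k, rfl⟩ : ∃ k : Fin (n + 1), k.castSucc = i := Fin.exists_castSucc_eq.2 hi
    have hk := congrFun h k
    simp only [face, Function.comp_apply, Fin.succAbove_castSucc_self,
      Fin.succAbove_of_castSucc_lt _ _ hij] at hk
    have hE := hp k
    rw [hk] at hE
    exact G.irrefl _ hE
  intro i j h
  rcases lt_trichotomy i j with hij | hij | hij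
  · exact absurd h (key i j hij)
  · exact hij
  · exact absurd h.symm (key j i hij)

lemma boundary_unitP_apply {n : ℕ} (p : Path V (n + 1)) (q : Path V n) :
    boundary V n (unitP p) q =
      ∑ i : Fin (n + 2), ((-1 : ℝ) ^ (i : ℕ)) * (if face i p = q then 1 else 0) := by
  change boundaryFun (unitP p) q = _
  rw [boundaryFun, Finset.sum_eq_single p]
  · simp [unitP]
  · intro b _ hb
    simp [unitP, hb]
  · simp

/-- The faces of an allowed path are exactly the paths occurring in its boundary. -/
lemma boundary_unitP_ne_zero_iff {n : ℕ} {G : Digraph V} {p : Path V (n + 1)} (hp : Allowed G p)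
    (q : Path V n) : boundary V n (unitP p) q ≠ 0 ↔ IsFace q p := by
  rw [boundary_unitP_apply]
  constructor
  · intro h
    obtain ⟨i, -, hi⟩ := Finset.exists_ne_zero_of_sum_ne_zero h
    by_contra hq
    exact hi (by rw [if_neg fun h' => hq ⟨i, h'⟩, mul_zero])
  · rintro ⟨i, rfl⟩
    rw [Finset.sum_eq_single i]
    · simp
    · intro j _ hj
      rw [if_neg fun h => hj (face_injective hp h), mul_zero]
    · simp

lemma fPath_le_of_isFace {V : Type} {f : V → ℝ} (hf : ∀ v, 0 ≤ f v) {n : ℕ} {q : Path V n}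
    {p : Path V (n + 1)} (h : IsFace q p) : fPath f q ≤ fPath f p := by
  obtain ⟨i, rfl⟩ := h
  rw [fPath, fPath, Fin.sum_univ_succAbove _ i]
  simpa [face] using hf (p i)

/-- A sum of exponentials with nonnegative weights and nonpositive rates decays at infinity
iff no rate of nonzero weight vanishes. -/
lemma tendsto_sum_mul_exp_iff {ι : Type*} [Fintype ι] (w a : ι → ℝ) (hw : ∀ i, 0 ≤ w i)
    (ha : ∀ i, w i ≠ 0 → a i ≤ 0) :
    Filter.Tendsto (fun t : ℝ => ∑ i, w i * Real.exp (2 * t * a i)) Filter.atTop (nhds 0) ↔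
      ∀ i, w i ≠ 0 → a i ≠ 0 := by
  constructor
  · intro h i hi h0
    refine absurd (ge_of_tendsto' h (b := w i) fun t => ?_) ((hw i).lt_of_ne' hi).not_ge
    refine le_trans ?_ (Finset.single_le_sum (fun j _ => ?_) (Finset.mem_univ i))
    · simp [h0]
    · exact mul_nonneg (hw j) (Real.exp_pos _).le
  · intro h
    suffices Filter.Tendsto (fun t : ℝ => ∑ i, w i * Real.exp (2 * t * a i)) Filter.atTop
        (nhds (∑ _i : ι, (0 : ℝ))) by simpa only [Finset.sum_const_zero] using this
    refine tendsto_finsetSum _ fun i _ => ?_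
    by_cases hi : w i = 0
    · simp [hi]
    · rw [← mul_zero (w i)]
      refine (Real.tendsto_exp_atBot.comp ?_).const_mul _
      refine Filter.Tendsto.atTop_mul_const_of_neg ((ha i hi).lt_of_ne (h i hi)) ?_
      exact Filter.tendsto_id.const_mul_atTop two_pos

/-- The squared incidence number `⟨∂p, q⟩²`, switched on by the condition `P`. -/
noncomputable def incidenceWeight (P : Prop) {n : ℕ} (p : Path V (n + 1)) (q : Path V n) : ℝ :=
  (if P then 1 else 0) * (boundary V n (unitP p) q) ^ 2

lemma incidenceWeight_nonneg (P : Prop) {n : ℕ} (p : Path V (n + 1)) (q : Path V n) :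
    0 ≤ incidenceWeight P p q := by
  unfold incidenceWeight
  split_ifs <;> positivity

lemma incidenceWeight_ne_zero_iff {G : Digraph V} {P : Prop} {n : ℕ} {p : Path V (n + 1)}
    (hp : P → Allowed G p) (q : Path V n) :
    incidenceWeight P p q ≠ 0 ↔ P ∧ IsFace q p := by
  by_cases h : P
  · simpa [incidenceWeight, h] using boundary_unitP_ne_zero_iff (hp h) q
  · simp [incidenceWeight, h]

/-- `λ_α(t) → 0` as `t → ∞` iff `α` is critical. -/
theorem stmt5 {V : Type} [Fintype V] [DecidableEq V] (G : Digraph V) (f : V → ℝ)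
    (hG : G.Transitive) (hf : IsMorse G f) (n : ℕ) (α : Path V n) (hα : Allowed G α) :
    Filter.Tendsto (lam G f n α) Filter.atTop (nhds 0) ↔ IsCritical G f α := by
  have hco : ∀ {k : ℕ} (p : Path V k) (γ : Path V (k + 1)),
      incidenceWeight (Allowed G γ) γ p ≠ 0 ↔ Allowed G γ ∧ IsFace p γ :=
    fun p _ => incidenceWeight_ne_zero_iff id p
  cases n with
  | zero =>
    have h := tendsto_sum_mul_exp_iff (fun γ : Path V 1 => incidenceWeight (Allowed G γ) γ α)
      (fun γ => fPath f α - fPath f γ) (fun γ => incidenceWeight_nonneg _ γ α)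
      fun γ hγ => sub_nonpos.2 (fPath_le_of_isFace hf.1 ((hco α γ).1 hγ).2)
    refine h.trans ?_
    simp only [hco, IsCritical, HasEqualCoface, HasEqualFace, hα, not_false_eq_true, and_true,
      true_and, not_exists, not_and, and_imp, ne_eq, sub_eq_zero, eq_comm (a := fPath f α)]
  | succ m =>
    have hface : ∀ β : Path V m,
        incidenceWeight (Allowed G β) α β ≠ 0 ↔ Allowed G β ∧ IsFace β α :=
      fun β => incidenceWeight_ne_zero_iff (fun _ => hα) β
    have h := tendsto_sum_mul_exp_iff
      (Sum.elim (fun β : Path V m => incidenceWeight (Allowed G β) α β)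
        (fun γ : Path V (m + 2) => incidenceWeight (Allowed G γ) γ α))
      (Sum.elim (fun β => fPath f β - fPath f α) (fun γ => fPath f α - fPath f γ))
      (Sum.rec (fun _ => incidenceWeight_nonneg _ _ _) (fun _ => incidenceWeight_nonneg _ _ _))
      (Sum.rec
        (fun β hβ => sub_nonpos.2 (fPath_le_of_isFace hf.1 ((hface β).1 hβ).2))
        (fun γ hγ => sub_nonpos.2 (fPath_le_of_isFace hf.1 ((hco α γ).1 hγ).2)))
    simp only [Fintype.sum_sum_type, Sum.elim_inl, Sum.elim_inr, Sum.forall] at h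
    refine h.trans ?_
    simp only [hco, hface, IsCritical, HasEqualCoface, HasEqualFace, hα, true_and, not_exists,
      not_and, and_imp, ne_eq, sub_eq_zero, eq_comm (a := fPath f α)]
    exact and_comm

end PathMorse
end

section
/- Let G be a transitive digraph and f a discrete Morse function on G. Let α = uv be a critical allowed elementary 1-path such that at least one of the vertices u, v (as 0-paths) is not critical. Then Φ(α) ≠ α (so α ∉ P₁^Φ(G)), while Φ(α + V∂(α)) = α + V∂(α) (so α + V∂(α) ∈ P₁^Φ(G)), where V = grad f and Φ = Id + ∂V + V∂. -/
open scoped BigOperators Classical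

namespace PathMorse

variable {V : Type} [Fintype V] [DecidableEq V]

theorem boundary_unitP {V : Type} [Fintype V] [DecidableEq V] {n : ℕ} (p : Path V (n+1)) :
    boundary V n (unitP p) = ∑ i : Fin (n+2), ((-1:ℝ)^(i:ℕ)) • unitP (face i p) := by
  funext q
  change boundaryFun (unitP p) q = _
  simp [boundaryFun, unitP, Pi.single_apply, Finset.sum_apply, eq_comm]

theorem boundary_unitP_edge {V : Type} [Fintype V] [DecidableEq V] (p : Path V 1) :
    boundary V 0 (unitP p) = unitP (fun _ : Fin 1 => p 1) - unitP (fun _ : Fin 1 => p 0) := by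
  have h0 : face 0 p = fun _ : Fin 1 => p 1 := by
    funext i; fin_cases i; rfl
  have h1 : face 1 p = fun _ : Fin 1 => p 0 := by
    funext i; fin_cases i; rfl
  rw [boundary_unitP, Fin.sum_univ_two, h0, h1]
  simp [sub_eq_add_neg]

theorem grad_unitP {V : Type} [Fintype V] [DecidableEq V] (G : Digraph V) (f : V → ℝ) {n : ℕ}
    (p : Path V n) : grad G f n (unitP p) = gradFun G f p := by
  change ∑ q : Path V n, unitP p q • gradFun G f q = _
  rw [Finset.sum_eq_single p]
  · simp [unitP]
  · intro q _ hq
    simp [unitP, hq]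
  · simp

theorem gradFun_eq_zero {V : Type} [Fintype V] [DecidableEq V] {G : Digraph V} {f : V → ℝ} {n : ℕ}
    {p : Path V n} (h : ¬ HasEqualCoface G f p) : gradFun G f p = 0 :=
  dif_neg fun h' => h h'.2

theorem IsFace.exists_vertex {V : Type} {n : ℕ} {q : Path V n} {p : Path V (n+1)}
    (h : IsFace q p) (f : V → ℝ) (hpq : fPath f p = fPath f q) :
    ∃ i : Fin (n+2), face i p = q ∧ f (p i) = 0 := by
  obtain ⟨i, rfl⟩ := h
  refine ⟨i, rfl, ?_⟩
  rw [fPath, Fin.sum_univ_succAbove _ i] at hpq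
  simpa [fPath, face] using hpq

/-- On a transitive digraph, all pairs of vertices of an allowed path are joined by an edge. -/
theorem Allowed.edge_of_lt {V : Type} {G : Digraph V} (hG : G.Transitive) {n : ℕ} {p : Path V n}
    (hp : Allowed G p) {i j : Fin (n+1)} (hij : i < j) : G.E (p i) (p j) := by
  induction j using Fin.induction with
  | zero => exact absurd hij (Fin.not_lt_zero i)
  | succ k ih =>
    rcases (Fin.le_castSucc_iff.mpr hij).eq_or_lt with h | h
    · exact h ▸ hp k
    · exact hG _ _ _ (ih h) (hp k)

/-- Two zeros of a discrete Morse function are never joined by an edge. -/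
theorem IsMorse.not_edge_of_zero {V : Type} {G : Digraph V} {f : V → ℝ} (hf : IsMorse G f)
    {a b : V} (ha : f a = 0) (hb : f b = 0) : ¬ G.E a b := by
  intro hab
  have key := hf.2.2 0 ![a, b] (fun i => by fin_cases i; exact hab)
    (fun _ => a) (fun _ => b) (fun i => i.elim0) (fun i => i.elim0)
    ⟨1, by funext i; fin_cases i; rfl⟩ ⟨0, by funext i; fin_cases i; rfl⟩
    (by simp [fPath, ha, hb]) (by simp [fPath, ha, hb])
  have : a = b := congrFun key 0
  exact G.irrefl b (this ▸ hab)

/-- An allowed path through a zero of a discrete Morse function has no coface of equal value. -/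
theorem IsMorse.not_hasEqualCoface {V : Type} {G : Digraph V} (hG : G.Transitive) {f : V → ℝ}
    (hf : IsMorse G f) {n : ℕ} {p : Path V n} {k : Fin (n+1)} (hk : f (p k) = 0) :
    ¬ HasEqualCoface G f p := by
  rintro ⟨γ, hγ, hface, heq⟩
  obtain ⟨i, rfl, hi⟩ := hface.exists_vertex f heq
  have hne : i.succAbove k ≠ i := Fin.succAbove_ne i k
  rcases hne.lt_or_gt with h | h
  · exact hf.not_edge_of_zero hk hi (hγ.edge_of_lt hG h)
  · exact hf.not_edge_of_zero hi hk (hγ.edge_of_lt hG h)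

/-- The gradient of a vertex `w`: either `w` is critical and the gradient vanishes, or it is the
edge, suitably signed, joining `w` to a zero of `f`. -/
theorem gradFun_vertex {V : Type} [Fintype V] [DecidableEq V] (G : Digraph V) (f : V → ℝ) (w : V) :
    (IsCritical G f (fun _ : Fin 1 => w) ∧ gradFun G f (fun _ : Fin 1 => w) = 0) ∨
    ∃ γ : Path V 1, γ 0 ≠ γ 1 ∧
      ((f (γ 0) = 0 ∧ γ 1 = w ∧ gradFun G f (fun _ : Fin 1 => w) = -unitP γ) ∨
        (f (γ 1) = 0 ∧ γ 0 = w ∧ gradFun G f (fun _ : Fin 1 => w) = unitP γ)) := by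
  have hw : Allowed G (fun _ : Fin 1 => w) := fun i => i.elim0
  by_cases h : HasEqualCoface G f (fun _ : Fin 1 => w)
  · right
    have hdef : Allowed G (fun _ : Fin 1 => w) ∧ HasEqualCoface G f (fun _ : Fin 1 => w) := ⟨hw, h⟩
    obtain ⟨γ, hγ, hface, heq, hgrad⟩ : ∃ γ : Path V 1, Allowed G γ ∧
        IsFace (fun _ : Fin 1 => w) γ ∧ fPath f γ = fPath f (fun _ : Fin 1 => w) ∧
        gradFun G f (fun _ : Fin 1 => w) =
          (-(boundary V 0 (unitP γ) (fun _ : Fin 1 => w))) • unitP γ :=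
      ⟨_, h.choose_spec.1, h.choose_spec.2.1, h.choose_spec.2.2, dif_pos hdef⟩
    have hne : γ 0 ≠ γ 1 := fun h01 => G.irrefl (γ 0) (by
      have := hγ 0
      change G.E (γ 0) (γ 1) at this
      rwa [← h01] at this)
    have hconst : ∀ {a b : V}, ((fun _ : Fin 1 => a) = fun _ => b) ↔ a = b :=
      ⟨fun h => congrFun h 0, fun h => by rw [h]⟩
    obtain ⟨i, hi, hzero⟩ := hface.exists_vertex f heq
    refine ⟨γ, hne, ?_⟩
    rw [boundary_unitP_edge] at hgrad
    fin_cases i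
    · have h1 : γ 1 = w := congrFun hi 0
      refine Or.inl ⟨hzero, h1, ?_⟩
      subst h1
      simpa [unitP, Pi.single_apply, hconst, hne.symm] using hgrad
    · have h0 : γ 0 = w := congrFun hi 0
      refine Or.inr ⟨hzero, h0, ?_⟩
      subst h0
      simpa [unitP, Pi.single_apply, hconst, hne] using hgrad
  · exact Or.inl ⟨⟨hw, h, id⟩, gradFun_eq_zero h⟩

theorem grad_grad_vertex {V : Type} [Fintype V] [DecidableEq V] {G : Digraph V} (hG : G.Transitive)
    {f : V → ℝ} (hf : IsMorse G f) (w : V) :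
    grad G f 1 (gradFun G f (fun _ : Fin 1 => w)) = 0 := by
  rcases gradFun_vertex G f w with ⟨-, h⟩ | ⟨γ, -, ⟨hz, -, h⟩ | ⟨hz, -, h⟩⟩
  · rw [h, map_zero]
  · rw [h, map_neg, grad_unitP, gradFun_eq_zero (hf.not_hasEqualCoface hG hz), neg_zero]
  · rw [h, grad_unitP, gradFun_eq_zero (hf.not_hasEqualCoface hG hz)]

theorem grad_boundary_grad_vertex {V : Type} [Fintype V] [DecidableEq V] {G : Digraph V}
    (hG : G.Transitive) {f : V → ℝ} (hf : IsMorse G f) (w : V) :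
    grad G f 0 (boundary V 0 (gradFun G f (fun _ : Fin 1 => w))) =
      -gradFun G f (fun _ : Fin 1 => w) := by
  have hzero : ∀ z, f z = 0 → gradFun G f (fun _ : Fin 1 => z) = 0 := fun z hz =>
    gradFun_eq_zero (hf.not_hasEqualCoface (p := fun _ : Fin 1 => z) (k := 0) hG hz)
  rcases gradFun_vertex G f w with ⟨-, h⟩ | ⟨γ, -, ⟨hz, rfl, h⟩ | ⟨hz, rfl, h⟩⟩
  · simp [h]
  · conv_lhs => rw [h]
    simp [boundary_unitP_edge, grad_unitP, hzero _ hz]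
  · conv_lhs => rw [h]
    simp [boundary_unitP_edge, grad_unitP, hzero _ hz]

/-- The gradients of two distinct vertices at which `f` does not vanish agree only if both vertices
are critical. -/
theorem isCritical_of_gradFun_eq {V : Type} [Fintype V] [DecidableEq V] {G : Digraph V}
    {f : V → ℝ} {v w : V} (hvw : v ≠ w) (hv : f v ≠ 0) (hw : f w ≠ 0)
    (h : gradFun G f (fun _ : Fin 1 => v) = gradFun G f (fun _ : Fin 1 => w)) :
    IsCritical G f (fun _ : Fin 1 => v) ∧ IsCritical G f (fun _ : Fin 1 => w) := by
  have hself : ∀ γ : Path V 1, unitP γ γ = 1 := fun γ => by simp [unitP]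
  have hother : ∀ γ δ : Path V 1, γ ≠ δ → unitP γ δ = 0 := fun γ δ hne => by
    simp [unitP, hne.symm]
  rcases gradFun_vertex G f v with ⟨hv', h₁⟩ | ⟨γ, -, h₁⟩ <;>
    rcases gradFun_vertex G f w with ⟨hw', h₂⟩ | ⟨δ, -, h₂⟩
  · exact ⟨hv', hw'⟩
  · have := congrFun h δ
    rw [h₁] at this
    rcases h₂ with ⟨-, -, h₂⟩ | ⟨-, -, h₂⟩ <;> simp [h₂, hself] at this
  · have := congrFun h γ
    rw [h₂] at this
    rcases h₁ with ⟨-, -, h₁⟩ | ⟨-, -, h₁⟩ <;> simp [h₁, hself] at this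
  · have hne : γ ≠ δ := by
      rintro rfl
      grind
    have := congrFun h γ
    rcases h₁ with ⟨-, -, h₁⟩ | ⟨-, -, h₁⟩ <;> rcases h₂ with ⟨-, -, h₂⟩ | ⟨-, -, h₂⟩ <;>
      simp [h₁, h₂, hself, hother _ _ hne.symm] at this

/-- `f` vanishes at neither endpoint of a critical edge. -/
theorem IsCritical.vertex_ne_zero {V : Type} {G : Digraph V} {f : V → ℝ} {α : Path V 1}
    (hα : IsCritical G f α) (i : Fin 2) : f (α i) ≠ 0 := by
  intro hi
  refine hα.2.2 ⟨face i α, fun j => j.elim0, ⟨i, rfl⟩, ?_⟩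
  rw [fPath, fPath, Fin.sum_univ_succAbove (fun j => f (α j)) i, hi, zero_add]
  rfl

/-- For a critical allowed 1-path `α = uv` on a transitive digraph such that `u` or
`v` is not critical, `Φ(α) ≠ α` while `Φ(α + V∂α) = α + V∂α`. -/
theorem stmt8 {V : Type} [Fintype V] [DecidableEq V] (G : Digraph V) (f : V → ℝ)
    (hG : G.Transitive) (hf : IsMorse G f) (α : Path V 1) (hα : IsCritical G f α)
    (h : ¬ IsCritical G f (fun _ : Fin 1 => α 0) ∨ ¬ IsCritical G f (fun _ : Fin 1 => α 1)) :
    flow G f 1 (unitP α) ≠ unitP α ∧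
    flow G f 1 (unitP α + vd G f 1 (unitP α)) = unitP α + vd G f 1 (unitP α) := by
  have hflow : ∀ x, flow G f 1 x =
      x + boundary V 1 (grad G f 1 x) + grad G f 0 (boundary V 0 x) := fun _ => rfl
  have hvd : vd G f 1 (unitP α) =
      gradFun G f (fun _ : Fin 1 => α 1) - gradFun G f (fun _ : Fin 1 => α 0) := by
    change grad G f 0 (boundary V 0 (unitP α)) = _
    rw [boundary_unitP_edge, map_sub, grad_unitP, grad_unitP]
  have hgα : grad G f 1 (unitP α) = 0 := by
    rw [grad_unitP, gradFun_eq_zero hα.2.1]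
  have hgb : grad G f 0 (boundary V 0 (unitP α)) =
      gradFun G f (fun _ : Fin 1 => α 1) - gradFun G f (fun _ : Fin 1 => α 0) := hvd
  constructor
  · rw [hflow, hgα, map_zero, add_zero, hgb]
    intro heq
    have hne : α 1 ≠ α 0 := fun h10 => G.irrefl (α 0) (by
      have := hα.1 0
      change G.E (α 0) (α 1) at this
      rwa [h10] at this)
    obtain ⟨h1, h0⟩ := isCritical_of_gradFun_eq hne (hα.vertex_ne_zero 1) (hα.vertex_ne_zero 0)
      (sub_eq_zero.mp (add_eq_left.mp heq))
    exact h.elim (fun h => h h0) (fun h => h h1)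
  · rw [hvd, hflow]
    simp only [map_add, map_sub, hgα, hgb, grad_grad_vertex hG hf,
      grad_boundary_grad_vertex hG hf, map_zero]
    abel

end PathMorse
end
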